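/- Lemma 4.11 (Localized transformation from undefined to true): Let φ ∈ L⁺ and let (𝒞,X) be a star-finite pointed simplicial model with 𝒞,X ⋈̸ φ. Then there exists a formula δ ∈ L⁺ such that: (1) 𝒞,X ⊨ ¬δ; and (2) for every pointed simplicial model (𝒞',X'), if 𝒞',X' ⋈ φ then 𝒞',X' ⊨ δ. -/

import Mathlib

namespace ISC

/-- Epistemic language `L⁺`: global atoms, local atoms, negation, conjunction,
and the possibility modality `K̂ₐ`. Local atoms are elements of `P`, with
`π : P → A` assigning to each local atom its owner agent. -/
inductive Form (A P : Type) : Type where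
  | glob : A → Form A P
  | atom : P → Form A P
  | neg  : Form A P → Form A P
  | conj : Form A P → Form A P → Form A P
  | know : A → Form A P → Form A P

/-- Formulas of the language `L⁻`, i.e., without global atoms. -/
def Form.NoGlobal {A P : Type} : Form A P → Prop
  | .glob _ => False
  | .atom _ => True
  | .neg φ => φ.NoGlobal
  | .conj φ ψ => φ.NoGlobal ∧ ψ.NoGlobal
  | .know _ φ => φ.NoGlobal

/-- Subformula relation. -/
inductive Form.Subformula {A P : Type} : Form A P → Form A P → Prop where
  | refl (φ : Form A P) : Form.Subformula φ φ
  | neg {ψ φ : Form A P} : Form.Subformula ψ φ → Form.Subformula ψ (.neg φ)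
  | conj_left {ψ φ χ : Form A P} : Form.Subformula ψ φ → Form.Subformula ψ (.conj φ χ)
  | conj_right {ψ φ χ : Form A P} : Form.Subformula ψ χ → Form.Subformula ψ (.conj φ χ)
  | know {ψ φ : Form A P} {a : A} : Form.Subformula ψ φ → Form.Subformula ψ (.know a φ)

/-- A (data of a) simplicial model: a collection of simplexes (sets of vertices),
a chromatic map and a valuation. -/
structure SimpModel (A P : Type) (π : P → A) (V : Type) : Type where
  C : Set (Set V)
  χ : V → A
  ℓ : V → Set P

namespace SimpModel

variable {A P : Type} {π : P → A} {V V' : Type}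

/-- The axioms of a simplicial model. -/
def IsWellFormed (M : SimpModel A P π V) : Prop :=
  M.C.Nonempty ∧
  (∀ X ∈ M.C, X.Finite ∧ X.Nonempty) ∧
  (∀ X ∈ M.C, ∀ Y : Set V, Y.Nonempty → Y ⊆ X → Y ∈ M.C) ∧
  (∀ v : V, {v} ∈ M.C) ∧
  (∀ X ∈ M.C, ∀ u ∈ X, ∀ w ∈ X, M.χ u = M.χ w → u = w) ∧
  (∀ v : V, ∀ p ∈ M.ℓ v, π p = M.χ v)

/-- A facet: a ⊆-maximal simplex. -/
def isFacet (M : SimpModel A P π V) (X : Set V) : Prop :=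
  X ∈ M.C ∧ ∀ Y ∈ M.C, X ⊆ Y → X = Y

/-- `ℓ(X)`, the local atoms of a simplex. -/
def lab (M : SimpModel A P π V) (X : Set V) : Set P := ⋃ v ∈ X, M.ℓ v

/-- Definability `𝒞,X ⋈ φ`. -/
def defined (M : SimpModel A P π V) : Set V → Form A P → Prop
  | _, .glob _ => True
  | X, .atom p => π p ∈ M.χ '' X
  | X, .neg φ => M.defined X φ
  | X, .conj φ ψ => M.defined X φ ∧ M.defined X ψ
  | X, .know a φ => ∃ Y : Set V, M.isFacet Y ∧ a ∈ M.χ '' (X ∩ Y) ∧ M.defined Y φ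

/-- Satisfaction `𝒞,X ⊨ φ`. -/
def sat (M : SimpModel A P π V) : Set V → Form A P → Prop
  | X, .glob a => a ∈ M.χ '' X
  | X, .atom p => p ∈ M.lab X
  | X, .neg φ => M.defined X φ ∧ ¬ M.sat X φ
  | X, .conj φ ψ => M.sat X φ ∧ M.sat X ψ
  | X, .know a φ => ∃ Y : Set V, M.isFacet Y ∧ a ∈ M.χ '' (X ∩ Y) ∧ M.sat Y φ

/-- Star-finiteness: each facet has only finitely many `a`-adjacent facets. -/
def StarFinite (M : SimpModel A P π V) : Prop :=
  ∀ (a : A) (X : Set V), M.isFacet X →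
    {Y : Set V | M.isFacet Y ∧ a ∈ M.χ '' (X ∩ Y)}.Finite

end SimpModel

/-- Modal equivalence of pointed simplicial models in a language `L`. -/
def ModEquiv {A P : Type} {π : P → A} {V V' : Type} (L : Set (Form A P))
    (M : SimpModel A P π V) (X : Set V)
    (M' : SimpModel A P π V') (X' : Set V') : Prop :=
  ∀ φ ∈ L,
    (M.defined X φ ↔ M'.defined X' φ) ∧
    (M.sat X φ ↔ M'.sat X' φ) ∧
    (M.sat X (.neg φ) ↔ M'.sat X' (.neg φ))

/-- `B` is a bisimulation between the simplicial models `M` and `M'`. -/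
def IsBisim {A P : Type} {π : P → A} {V V' : Type}
    (M : SimpModel A P π V) (M' : SimpModel A P π V')
    (B : Set V → Set V' → Prop) : Prop :=
  (∃ X X', B X X') ∧
  (∀ X X', B X X' → M.isFacet X ∧ M'.isFacet X') ∧
  (∀ X X', B X X' →
    (M.χ '' X = M'.χ '' X' ∧ M.lab X = M'.lab X') ∧
    (∀ (a : A) (Y : Set V), M.isFacet Y → a ∈ M.χ '' (X ∩ Y) →
      ∃ Y' : Set V', M'.isFacet Y' ∧ a ∈ M'.χ '' (X' ∩ Y') ∧ B Y Y') ∧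
    (∀ (a : A) (Y' : Set V'), M'.isFacet Y' → a ∈ M'.χ '' (X' ∩ Y') →
      ∃ Y : Set V, M.isFacet Y ∧ a ∈ M.χ '' (X ∩ Y) ∧ B Y Y'))

/-- Bisimilarity of pointed simplicial models. -/
def Bisimilar {A P : Type} {π : P → A} {V V' : Type}
    (M : SimpModel A P π V) (X : Set V)
    (M' : SimpModel A P π V') (X' : Set V') : Prop :=
  ∃ B, IsBisim M M' B ∧ B X X'

/-- Labeled rooted trees: a node carries a set of agents, each edge to a child
carries an agent. -/
inductive LTree (A : Type) : Type where
  | node : Set A → List (A × LTree A) → LTree A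

namespace LTree

/-- The label of the root. -/
def label {A : Type} : LTree A → Set A
  | .node s _ => s

/-- The list of children of the root, paired with their edge labels. -/
def children {A : Type} : LTree A → List (A × LTree A)
  | .node _ cs => cs

/-- The `a`-grafting: add `a` to the root label. -/
def graft {A : Type} (a : A) : LTree A → LTree A
  | .node s cs => .node (insert a s) cs

/-- The life-tree condition: every `a`-edge satisfies `a ∈ L(σ) ∩ L(τ)`. -/
def IsLife {A : Type} : LTree A → Prop
  | .node s cs => ∀ p ∈ cs, p.1 ∈ s ∧ p.1 ∈ p.2.label ∧ p.2.IsLife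
  decreasing_by
    rename_i h
    have h2 := List.sizeOf_lt_of_mem h
    obtain ⟨x, y⟩ := p
    simp at h2 ⊢
    omega

end LTree

/-- The life tree `ℒ⟨φ⟩` of a formula. -/
def Form.lifeTree {A P : Type} (π : P → A) : Form A P → LTree A
  | .glob _ => .node ∅ []
  | .atom p => .node {π p} []
  | .neg φ => φ.lifeTree π
  | .conj φ ψ =>
      .node ((φ.lifeTree π).label ∪ (ψ.lifeTree π).label)
            ((φ.lifeTree π).children ++ (ψ.lifeTree π).children)
  | .know a φ => .node {a} [(a, LTree.graft a (φ.lifeTree π))]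

/-- `𝒞,X ⋈ 𝔗`: there is an embedding of the tree `𝔗` into `(𝒞,X)`, i.e., a map
from tree nodes to facets sending the root to `X`, node labels into the colors
of the corresponding facets, and every `a`-edge to a pair of `a`-adjacent facets. -/
def SimpModel.Embeds {A P : Type} {π : P → A} {V : Type}
    (M : SimpModel A P π V) : Set V → LTree A → Prop
  | X, .node s cs =>
      s ⊆ M.χ '' X ∧
      ∀ p ∈ cs, ∃ Y : Set V, M.isFacet Y ∧ p.1 ∈ M.χ '' (X ∩ Y) ∧ M.Embeds Y p.2
  decreasing_by
    rename_i h
    have h2 := List.sizeOf_lt_of_mem h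
    obtain ⟨x, y⟩ := p
    simp at h2 ⊢
    omega

/-- A (data of a) partial epistemic model: a relation for every agent and a
valuation assigning to states sets of global (`Sum.inl`) and local (`Sum.inr`) atoms. -/
structure PEModel (A P : Type) (π : P → A) (S : Type) : Type where
  rel : A → S → S → Prop
  L : S → Set (A ⊕ P)

namespace PEModel

variable {A P : Type} {π : P → A} {S S' : Type}

/-- The axioms of a partial epistemic model: each `∼ₐ` is a partial equivalence
relation (symmetric and transitive) and proper, local atoms of live agents are
constant on `∼ₐ`-classes, and the global atom `a` holds exactly where `a` is alive. -/
def IsWellFormed (M : PEModel A P π S) : Prop :=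
  (∀ (a : A) (s t : S), M.rel a s t → M.rel a t s) ∧
  (∀ (a : A) (s t u : S), M.rel a s t → M.rel a t u → M.rel a s u) ∧
  (∀ s t : S, s ≠ t → ∃ b : A, M.rel b s s ∧ ¬ M.rel b s t) ∧
  (∀ (a : A) (p : P), π p = a → ∀ s t : S, M.rel a s t →
      (Sum.inr p ∈ M.L s ↔ Sum.inr p ∈ M.L t)) ∧
  (∀ (a : A) (s : S), Sum.inl a ∈ M.L s ↔ M.rel a s s)

/-- Definability `M,s ⋈ φ` on partial epistemic models. -/
def defined (M : PEModel A P π S) : S → Form A P → Prop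
  | _, .glob _ => True
  | s, .atom p => M.rel (π p) s s
  | s, .neg φ => M.defined s φ
  | s, .conj φ ψ => M.defined s φ ∧ M.defined s ψ
  | s, .know a φ => ∃ t : S, M.rel a t s ∧ M.defined t φ

/-- Satisfaction `M,s ⊨ φ` on partial epistemic models. -/
def sat (M : PEModel A P π S) : S → Form A P → Prop
  | s, .glob a => M.rel a s s
  | s, .atom p => M.rel (π p) s s ∧ Sum.inr p ∈ M.L s
  | s, .neg φ => M.defined s φ ∧ ¬ M.sat s φ
  | s, .conj φ ψ => M.sat s φ ∧ M.sat s ψ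
  | s, .know a φ => ∃ t : S, M.rel a t s ∧ M.sat t φ

/-- Image-finiteness: every `∼ₐ`-equivalence class is finite. -/
def ImageFinite (M : PEModel A P π S) : Prop :=
  ∀ (a : A) (s : S), M.rel a s s → {t : S | M.rel a s t}.Finite

/-- The `∼ₐ`-class `[s]ₐ`. -/
def cls (M : PEModel A P π S) (a : A) (s : S) : Set S := {t | M.rel a s t}

/-- Vertices of `σ(M)`: pairs `([s]ₐ, a)` with `a` alive in `s`. -/
def SVtx (M : PEModel A P π S) : Type :=
  {va : Set S × A // ∃ s : S, M.rel va.2 s s ∧ va.1 = M.cls va.2 s}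

/-- The set of vertices `{([s]ₐ, a) | a ∈ B}`. -/
def sigmaSet (M : PEModel A P π S) (s : S) (B : Set A) : Set M.SVtx :=
  {v : M.SVtx | v.val.2 ∈ B ∧ v.val.1 = M.cls v.val.2 s}

/-- The simplicial model `σ(M)` associated with a partial epistemic model. -/
def sigma (M : PEModel A P π S) : SimpModel A P π M.SVtx where
  C := {X : Set M.SVtx |
    ∃ (s : S) (B : Set A), B.Nonempty ∧ (∀ a ∈ B, M.rel a s s) ∧ X = M.sigmaSet s B}
  χ := fun v => v.val.2
  ℓ := fun v => {p : P | π p = v.val.2 ∧ ∃ t ∈ v.val.1, Sum.inr p ∈ M.L t}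

/-- The facet `σ(s) = {([s]ₐ, a) | a ∈ Aₛ}`. -/
def sigmaF (M : PEModel A P π S) (s : S) : Set M.SVtx :=
  M.sigmaSet s {a : A | M.rel a s s}

end PEModel

/-- The partial epistemic model `κ(𝒞)` associated with a simplicial model:
states are the facets, `X ∼ₐ Y` iff `a ∈ χ(X ∩ Y)`, and `L(X) = ℓ(X) ∪ χ(X)`. -/
def SimpModel.kappa {A P : Type} {π : P → A} {V : Type} (M : SimpModel A P π V) :
    PEModel A P π {X : Set V // M.isFacet X} where
  rel := fun a X Y => a ∈ M.χ '' (X.val ∩ Y.val)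
  L := fun X => (Sum.inl '' (M.χ '' X.val)) ∪ (Sum.inr '' M.lab X.val)

/-- `Z` is a life bisimulation between partial epistemic models. -/
def IsLifeBisim {A P : Type} {π : P → A} {S S' : Type}
    (M : PEModel A P π S) (M' : PEModel A P π S') (Z : S → S' → Prop) : Prop :=
  (∃ s s', Z s s') ∧
  ∀ s s', Z s s' →
    ((∀ a : A, Sum.inl a ∈ M.L s ↔ Sum.inl a ∈ M'.L s') ∧
     (∀ a : A, M.rel a s s → ∀ p : P, π p = a →
        (Sum.inr p ∈ M.L s ↔ Sum.inr p ∈ M'.L s'))) ∧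
    (∀ a : A, M.rel a s s → ∀ t : S, M.rel a t s →
        ∃ t' : S', M'.rel a t' s' ∧ Z t t') ∧
    (∀ a : A, M'.rel a s' s' → ∀ t' : S', M'.rel a t' s' →
        ∃ t : S, M.rel a t s ∧ Z t t')

/-- `Z` is a standard bisimulation between partial epistemic models. -/
def IsStdBisim {A P : Type} {π : P → A} {S S' : Type}
    (M : PEModel A P π S) (M' : PEModel A P π S') (Z : S → S' → Prop) : Prop :=
  (∃ s s', Z s s') ∧
  ∀ s s', Z s s' →
    ((∀ a : A, Sum.inl a ∈ M.L s ↔ Sum.inl a ∈ M'.L s') ∧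
     (∀ p : P, Sum.inr p ∈ M.L s ↔ Sum.inr p ∈ M'.L s')) ∧
    (∀ (a : A) (t : S), M.rel a t s → ∃ t' : S', M'.rel a t' s' ∧ Z t t') ∧
    (∀ (a : A) (t' : S'), M'.rel a t' s' → ∃ t : S, M.rel a t s ∧ Z t t')

/-- Modal equivalence of pointed partial epistemic models (in `L⁺`). -/
def ModEquivPar {A P : Type} {π : P → A} {S S' : Type}
    (M : PEModel A P π S) (s : S) (M' : PEModel A P π S') (s' : S') : Prop :=
  ∀ φ : Form A P,
    (M.defined s φ ↔ M'.defined s' φ) ∧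
    (M.sat s φ ↔ M'.sat s' φ) ∧
    (M.sat s (.neg φ) ↔ M'.sat s' (.neg φ))


namespace SimpModel

variable {A P : Type} {π : P → A} {V : Type}

theorem IsWellFormed.defined_of_sat {M : SimpModel A P π V} (hM : M.IsWellFormed)
    (φ : Form A P) {X : Set V} (h : M.sat X φ) : M.defined X φ := by
  induction φ generalizing X with
  | glob a => trivial
  | atom p =>
    simp only [sat, lab, Set.mem_iUnion] at h
    obtain ⟨v, hv, hp⟩ := h
    exact ⟨v, hv, (hM.2.2.2.2.2 v p hp).symm⟩
  | neg φ _ => exact h.1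
  | conj φ ψ ihφ ihψ => exact ⟨ihφ h.1, ihψ h.2⟩
  | know a φ ih =>
    obtain ⟨Y, hY, ha, h⟩ := h
    exact ⟨Y, hY, ha, ih h⟩

end SimpModel

/-- `φ` entails `ψ` on all pointed simplicial models. -/
def Entails {A P : Type} (π : P → A) (φ ψ : Form A P) : Prop :=
  ∀ (V : Type) (M : SimpModel A P π V) (X : Set V),
    M.IsWellFormed → M.isFacet X → M.sat X φ → M.sat X ψ

/-- `ψ` refines `φ`: it entails `φ`, and it is defined wherever `φ` is true. -/
def Refines {A P : Type} (π : P → A) (φ ψ : Form A P) : Prop :=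
  Entails π ψ φ ∧
  ∀ (V : Type) (M : SimpModel A P π V) (X : Set V),
    M.IsWellFormed → M.isFacet X → M.sat X φ → M.defined X ψ

theorem Refines.conj_know {A P : Type} {π : P → A} {φ ψ : Form A P} (h : Refines π φ ψ)
    (θ : Form A P) (a : A) : Refines π (.conj θ (.know a φ)) (.conj θ (.know a ψ)) := by
  constructor
  · rintro V M X hM - ⟨hθ, Y, hY, ha, hψ⟩
    exact ⟨hθ, Y, hY, ha, h.1 V M Y hM hY hψ⟩
  · rintro V M X hM - ⟨hθ, Y, hY, ha, hφ⟩
    exact ⟨hM.defined_of_sat θ hθ, Y, hY, ha, h.2 V M Y hM hY hφ⟩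

/-- Starting from any `θ`, finitely many refinement steps lead to a formula that
expresses `θ` together with the definability of `φ`. -/
theorem exists_refinement_iff_defined {A P : Type} (π : P → A) (φ θ : Form A P) :
    ∃ θ' : Form A P, Relation.ReflTransGen (Refines π) θ θ' ∧
      ∀ (V : Type) (M : SimpModel A P π V) (X : Set V), M.IsWellFormed → M.isFacet X →
        (M.sat X θ' ↔ M.sat X θ ∧ M.defined X φ) := by
  have conj_glob (θ : Form A P) (a : A) : Refines π θ (.conj θ (.glob a)) :=
    ⟨fun _ _ _ _ _ h => h.1, fun _ _ _ hM _ h => ⟨hM.defined_of_sat θ h, trivial⟩⟩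
  induction φ generalizing θ with
  | glob a => exact ⟨θ, .refl, fun _ _ _ _ _ => (and_iff_left trivial).symm⟩
  | atom p => exact ⟨_, .single (conj_glob θ (π p)), fun _ _ _ _ _ => Iff.rfl⟩
  | neg φ ih => exact ih θ
  | conj φ ψ ihφ ihψ =>
    obtain ⟨θ₁, hc₁, h₁⟩ := ihφ θ
    obtain ⟨θ₂, hc₂, h₂⟩ := ihψ θ₁
    refine ⟨θ₂, hc₁.trans hc₂, fun V M X hM hX => ?_⟩
    rw [h₂ V M X hM hX, h₁ V M X hM hX, and_assoc]
    rfl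
  | know a φ ih =>
    obtain ⟨ξ, hc, hξ⟩ := ih (.glob a)
    have step : Refines π (.conj θ (.glob a)) (.conj θ (.know a (.glob a))) := by
      constructor
      · rintro V M X - - ⟨hθ, Y, -, ⟨v, hv, ha⟩, -⟩
        exact ⟨hθ, v, hv.1, ha⟩
      · rintro V M X hM hX ⟨hθ, v, hv, ha⟩
        exact ⟨hM.defined_of_sat θ hθ, X, hX, ⟨v, ⟨hv, hv⟩, ha⟩, trivial⟩
    refine ⟨.conj θ (.know a ξ), .head (conj_glob θ a) (.head step
      (hc.lift (fun ψ => Form.conj θ (.know a ψ)) fun _ _ h => h.conj_know θ a)),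
      fun V M X hM _ => and_congr_right fun _ => exists_congr fun Y =>
        and_congr_right fun hY => and_congr_right fun ha => ?_⟩
    rw [hξ V M Y hM hY]
    obtain ⟨v, hv, ha⟩ := ha
    exact and_iff_right ⟨v, hv.2, ha⟩

/-- Along a chain of refinements from a true formula to one that is not true, some formula
is false, i.e., defined but not true. -/
theorem exists_sat_neg_of_refinement {A P V : Type} {π : P → A} {M : SimpModel A P π V}
    (hM : M.IsWellFormed) {X : Set V} (hX : M.isFacet X) {θ θ' : Form A P}
    (hc : Relation.ReflTransGen (Refines π) θ θ') (hθ : M.sat X θ) (hθ' : ¬ M.sat X θ') :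
    ∃ δ : Form A P, M.sat X (.neg δ) ∧ Entails π θ' δ := by
  induction hc with
  | refl => exact absurd hθ hθ'
  | @tail ψ ξ _ hr ih =>
    by_cases hψ : M.sat X ψ
    · exact ⟨ξ, ⟨hr.2 V M X hM hX hψ, hθ'⟩, fun _ _ _ _ _ h => h⟩
    · obtain ⟨δ, hδ, he⟩ := ih hψ
      exact ⟨δ, hδ, fun V' M' X' hM' hX' h =>
        he V' M' X' hM' hX' (hr.1 V' M' X' hM' hX' h)⟩

/-- **Lemma 4.11 (Localized transformation from undefined to true).** If
`𝒞,X ⋈̸ φ` for a star-finite pointed simplicial model `(𝒞,X)`, then there is a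
formula `δ ∈ L⁺` such that (1) `𝒞,X ⊨ ¬δ`, and (2) for every pointed
simplicial model `(𝒞',X')`, if `𝒞',X' ⋈ φ` then `𝒞',X' ⊨ δ`. -/
theorem localized_transformation
    {A P V : Type} [Fintype A] [Countable P] {π : P → A}
    (M : SimpModel A P π V) (hM : M.IsWellFormed) (hSF : M.StarFinite)
    (X : Set V) (hX : M.isFacet X)
    (φ : Form A P) (hnd : ¬ M.defined X φ) :
    ∃ δ : Form A P,
      M.sat X (Form.neg δ) ∧
      ∀ (V' : Type) (M' : SimpModel A P π V') (X' : Set V'),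
        M'.IsWellFormed → M'.isFacet X' → M'.defined X' φ → M'.sat X' δ := by
  obtain ⟨v, -⟩ := (hM.2.1 X hX.1).2
  let a := M.χ v
  let top : Form A P := .neg (.conj (.glob a) (.neg (.glob a)))
  have sat_top (V' : Type) (M' : SimpModel A P π V') (X' : Set V') : M'.sat X' top :=
    ⟨⟨trivial, trivial⟩, fun h => h.2.2 h.1⟩
  obtain ⟨θ, hc, hθ⟩ := exists_refinement_iff_defined π φ top
  obtain ⟨δ, hδ, he⟩ := exists_sat_neg_of_refinement hM hX hc (sat_top V M X)
    fun h => hnd ((hθ V M X hM hX).1 h).2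
  exact ⟨δ, hδ, fun V' M' X' hM' hX' hd =>
    he V' M' X' hM' hX' ((hθ V' M' X' hM' hX').2 ⟨sat_top V' M' X', hd⟩)⟩

end ISC
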